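/- arXiv:1608.08779 — 6 statements merged into one kernel-verified Lean document; each statement's English description precedes it below -/
import Mathlib

section
/- (Identity for HyLL) For every HyLL formula A, every world w of the constraint domain, and every unbounded context Γ, the sequent Γ; A @ w ⊢ A @ w is derivable in HyLL. -/
/-!
HyLL (Hybrid Linear Logic) over a constraint domain: a monoid `⟨W, *, 1⟩` of worlds.
Formulas use higher-order abstract syntax for the binders (term quantifiers,
world quantifiers and the localization `↓u.A`), so substitution `A[w/u]` is
function application.
-/

namespace HyLL

/-- HyLL formulas over worlds `W`, atomic predicate names `A` and first-order terms `T`.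
Atoms are `p(t⃗)`.  Connectives: `⊗, 1, ⊸, &, ⊤, ⊕, 0, !`, quantifiers over terms and
worlds, and the hybrid connectives `(A at u)` and `↓u.A`. -/
inductive HF (W A T : Type) : Type where
  | atom : A → List T → HF W A T
  | tens : HF W A T → HF W A T → HF W A T
  | one : HF W A T
  | limp : HF W A T → HF W A T → HF W A T
  | with_ : HF W A T → HF W A T → HF W A T
  | top : HF W A T
  | plus : HF W A T → HF W A T → HF W A T
  | zero : HF W A T
  | bang : HF W A T → HF W A T
  | allT : (T → HF W A T) → HF W A T
  | exT : (T → HF W A T) → HF W A T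
  | allW : (W → HF W A T) → HF W A T
  | exW : (W → HF W A T) → HF W A T
  | att : HF W A T → W → HF W A T
  | down : (W → HF W A T) → HF W A T

/-- A HyLL judgment `A @ w`. -/
abbrev Jdg (W A T : Type) := HF W A T × W

variable {W A T : Type} [Monoid W]

/-- The HyLL sequent calculus: `HSeq Γ Δ C w` means `Γ; Δ ⊢ C @ w` is derivable,
where `Γ` is the unbounded context (a set) and `Δ` the linear context (a multiset). -/
inductive HSeq : Set (Jdg W A T) → Multiset (Jdg W A T) → HF W A T → W → Prop where
  | init (Γ) (a : A) (ts : List T) (w : W) :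
      HSeq Γ {(.atom a ts, w)} (.atom a ts) w
  | copy {Γ Δ B u C w} : (B, u) ∈ Γ →
      HSeq Γ ((B, u) ::ₘ Δ) C w → HSeq Γ Δ C w
  | tensR {Γ Δ Δ' B C w} : HSeq Γ Δ B w → HSeq Γ Δ' C w →
      HSeq Γ (Δ + Δ') (.tens B C) w
  | tensL {Γ Δ B C u D w} : HSeq Γ ((B, u) ::ₘ (C, u) ::ₘ Δ) D w →
      HSeq Γ ((.tens B C, u) ::ₘ Δ) D w
  | oneR (Γ) (w : W) : HSeq Γ 0 .one w
  | oneL {Γ Δ u C w} : HSeq Γ Δ C w → HSeq Γ ((.one, u) ::ₘ Δ) C w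
  | limpR {Γ Δ B C w} : HSeq Γ ((B, w) ::ₘ Δ) C w → HSeq Γ Δ (.limp B C) w
  | limpL {Γ Δ Δ' B C u D w} : HSeq Γ Δ B u → HSeq Γ ((C, u) ::ₘ Δ') D w →
      HSeq Γ ((.limp B C, u) ::ₘ (Δ + Δ')) D w
  | withR {Γ Δ B C w} : HSeq Γ Δ B w → HSeq Γ Δ C w → HSeq Γ Δ (.with_ B C) w
  | withL1 {Γ Δ B C u D w} : HSeq Γ ((B, u) ::ₘ Δ) D w →
      HSeq Γ ((.with_ B C, u) ::ₘ Δ) D w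
  | withL2 {Γ Δ B C u D w} : HSeq Γ ((C, u) ::ₘ Δ) D w →
      HSeq Γ ((.with_ B C, u) ::ₘ Δ) D w
  | topR (Γ Δ) (w : W) : HSeq Γ Δ .top w
  | plusR1 {Γ Δ B C w} : HSeq Γ Δ B w → HSeq Γ Δ (.plus B C) w
  | plusR2 {Γ Δ B C w} : HSeq Γ Δ C w → HSeq Γ Δ (.plus B C) w
  | plusL {Γ Δ B C u D w} : HSeq Γ ((B, u) ::ₘ Δ) D w → HSeq Γ ((C, u) ::ₘ Δ) D w →
      HSeq Γ ((.plus B C, u) ::ₘ Δ) D w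
  | zeroL (Γ Δ) (u : W) (C : HF W A T) (w : W) : HSeq Γ ((.zero, u) ::ₘ Δ) C w
  | bangR {Γ B w} : HSeq Γ 0 B w → HSeq Γ 0 (.bang B) w
  | bangL {Γ Δ B u C w} : HSeq (insert (B, u) Γ) Δ C w →
      HSeq Γ ((.bang B, u) ::ₘ Δ) C w
  | allTR {Γ Δ B w} : (∀ t : T, HSeq Γ Δ (B t) w) → HSeq Γ Δ (.allT B) w
  | allTL {Γ Δ B u C w} (t : T) : HSeq Γ ((B t, u) ::ₘ Δ) C w →
      HSeq Γ ((.allT B, u) ::ₘ Δ) C w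
  | exTR {Γ Δ B w} (t : T) : HSeq Γ Δ (B t) w → HSeq Γ Δ (.exT B) w
  | exTL {Γ Δ B u C w} : (∀ t : T, HSeq Γ ((B t, u) ::ₘ Δ) C w) →
      HSeq Γ ((.exT B, u) ::ₘ Δ) C w
  | allWR {Γ Δ B w} : (∀ v : W, HSeq Γ Δ (B v) w) → HSeq Γ Δ (.allW B) w
  | allWL {Γ Δ B u C w} (v : W) : HSeq Γ ((B v, u) ::ₘ Δ) C w →
      HSeq Γ ((.allW B, u) ::ₘ Δ) C w
  | exWR {Γ Δ B w} (v : W) : HSeq Γ Δ (B v) w → HSeq Γ Δ (.exW B) w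
  | exWL {Γ Δ B u C w} : (∀ v : W, HSeq Γ ((B v, u) ::ₘ Δ) C w) →
      HSeq Γ ((.exW B, u) ::ₘ Δ) C w
  | attR {Γ Δ B u w} : HSeq Γ Δ B u → HSeq Γ Δ (.att B u) w
  | attL {Γ Δ B u v C w} : HSeq Γ ((B, u) ::ₘ Δ) C w →
      HSeq Γ ((.att B u, v) ::ₘ Δ) C w
  | downR {Γ Δ B w} : HSeq Γ Δ (B w) w → HSeq Γ Δ (.down B) w
  | downL {Γ Δ B v C w} : HSeq Γ ((B v, v) ::ₘ Δ) C w →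
      HSeq Γ ((.down B, v) ::ₘ Δ) C w

end HyLL

/-- **Identity for HyLL.**  For every HyLL formula `A`, every world `w` of the
constraint domain and every unbounded context `Γ`, the sequent `Γ; A @ w ⊢ A @ w`
is derivable in HyLL. -/
theorem hyll_identity {W A T : Type} [Monoid W]
    (Γ : Set (HyLL.Jdg W A T)) (B : HyLL.HF W A T) (w : W) :
    HyLL.HSeq Γ {(B, w)} B w := by
  induction B generalizing Γ w with
  | atom a ts => exact .init Γ a ts w
  | tens B C hB hC => exact .tensL (.tensR (hB Γ w) (hC Γ w))
  | one => exact .oneL (.oneR Γ w)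
  | limp B C hB hC =>
    refine .limpR ?_
    rw [← Multiset.cons_zero (HyLL.HF.limp B C, w), Multiset.cons_swap]
    exact .limpL (Δ := {(B, w)}) (Δ' := 0) (hB Γ w) (hC Γ w)
  | with_ B C hB hC => exact .withR (.withL1 (hB Γ w)) (.withL2 (hC Γ w))
  | top => exact .topR Γ _ w
  | plus B C hB hC => exact .plusL (.plusR1 (hB Γ w)) (.plusR2 (hC Γ w))
  | zero => exact .zeroL Γ 0 w _ w
  | bang B hB =>
    exact .bangL (.bangR (.copy (Set.mem_insert (B, w) Γ) (hB _ w)))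
  | allT B hB => exact .allTR fun t => .allTL t (hB t Γ w)
  | exT B hB => exact .exTL fun t => .exTR t (hB t Γ w)
  | allW B hB => exact .allWR fun v => .allWL v (hB v Γ w)
  | exW B hB => exact .exWL fun v => .exWR v (hB v Γ w)
  | att B u hB => exact .attR (.attL (hB Γ u))
  | down B hB => exact .downR (.downL (hB w Γ w))
end

section
/- (Cut admissibility for HyLL, linear cut) If the sequents Γ; Δ ⊢ A @ u and Γ; Δ', A @ u ⊢ C @ w are derivable in HyLL, then the sequent Γ; Δ, Δ' ⊢ C @ w is derivable in HyLL. -/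
namespace HyLL

variable {W A T : Type}

theorem HSeq.congr_ctx {Γ : Set (Jdg W A T)} {Δ Δ' : Multiset (Jdg W A T)} {C : HF W A T} {w : W}
    (h : HSeq Γ Δ C w) (e : Δ = Δ') : HSeq Γ Δ' C w :=
  e ▸ h

/-- Weakening of the unbounded context. -/
theorem HSeq.mono {Γ Γ' : Set (Jdg W A T)} {Δ : Multiset (Jdg W A T)} {C : HF W A T} {w : W}
    (h : HSeq Γ Δ C w) (hΓ : Γ ⊆ Γ') : HSeq Γ' Δ C w := by
  induction h generalizing Γ' with
  | init => exact .init ..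
  | copy hm _ ih => exact .copy (hΓ hm) (ih hΓ)
  | tensR _ _ ih₁ ih₂ => exact .tensR (ih₁ hΓ) (ih₂ hΓ)
  | tensL _ ih => exact .tensL (ih hΓ)
  | oneR => exact .oneR ..
  | oneL _ ih => exact .oneL (ih hΓ)
  | limpR _ ih => exact .limpR (ih hΓ)
  | limpL _ _ ih₁ ih₂ => exact .limpL (ih₁ hΓ) (ih₂ hΓ)
  | withR _ _ ih₁ ih₂ => exact .withR (ih₁ hΓ) (ih₂ hΓ)
  | withL1 _ ih => exact .withL1 (ih hΓ)
  | withL2 _ ih => exact .withL2 (ih hΓ)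
  | topR => exact .topR ..
  | plusR1 _ ih => exact .plusR1 (ih hΓ)
  | plusR2 _ ih => exact .plusR2 (ih hΓ)
  | plusL _ _ ih₁ ih₂ => exact .plusL (ih₁ hΓ) (ih₂ hΓ)
  | zeroL => exact .zeroL ..
  | bangR _ ih => exact .bangR (ih hΓ)
  | bangL _ ih => exact .bangL (ih (Set.insert_subset_insert hΓ))
  | allTR _ ih => exact .allTR fun t => ih t hΓ
  | allTL t _ ih => exact .allTL t (ih hΓ)
  | exTR t _ ih => exact .exTR t (ih hΓ)
  | exTL _ ih => exact .exTL fun t => ih t hΓ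
  | allWR _ ih => exact .allWR fun v => ih v hΓ
  | allWL v _ ih => exact .allWL v (ih hΓ)
  | exWR v _ ih => exact .exWR v (ih hΓ)
  | exWL _ ih => exact .exWL fun v => ih v hΓ
  | attR _ ih => exact .attR (ih hΓ)
  | attL _ ih => exact .attL (ih hΓ)
  | downR _ ih => exact .downR (ih hΓ)
  | downL _ ih => exact .downL (ih hΓ)

/-- The premises of some right rule with conclusion `Γ; Δ ⊢ B @ u` are derivable. -/
def RightPremises (Γ : Set (Jdg W A T)) (Δ : Multiset (Jdg W A T)) (B : HF W A T) (u : W) : Prop :=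
  match B with
  | .atom a ts => Δ = {(.atom a ts, u)}
  | .tens B C => ∃ Δ₁ Δ₂, Δ = Δ₁ + Δ₂ ∧ HSeq Γ Δ₁ B u ∧ HSeq Γ Δ₂ C u
  | .one => Δ = 0
  | .limp B C => HSeq Γ ((B, u) ::ₘ Δ) C u
  | .with_ B C => HSeq Γ Δ B u ∧ HSeq Γ Δ C u
  | .top => True
  | .plus B C => HSeq Γ Δ B u ∨ HSeq Γ Δ C u
  | .zero => False
  | .bang B => Δ = 0 ∧ HSeq Γ 0 B u
  | .allT B => ∀ t, HSeq Γ Δ (B t) u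
  | .exT B => ∃ t, HSeq Γ Δ (B t) u
  | .allW B => ∀ v, HSeq Γ Δ (B v) u
  | .exW B => ∃ v, HSeq Γ Δ (B v) u
  | .att B v => HSeq Γ Δ B v
  | .down B => HSeq Γ Δ (B u) u

/-- The premises of some rule with conclusion `Γ; Δ, B @ u ⊢ D @ w` and principal judgment
`B @ u` on the left are derivable. -/
def LeftPremises (Γ : Set (Jdg W A T)) (Δ : Multiset (Jdg W A T)) (B : HF W A T) (u : W)
    (D : HF W A T) (w : W) : Prop :=
  match B with
  | .atom a ts => Δ = 0 ∧ D = .atom a ts ∧ w = u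
  | .tens B C => HSeq Γ ((B, u) ::ₘ (C, u) ::ₘ Δ) D w
  | .one => HSeq Γ Δ D w
  | .limp B C => ∃ Δ₁ Δ₂, Δ = Δ₁ + Δ₂ ∧ HSeq Γ Δ₁ B u ∧ HSeq Γ ((C, u) ::ₘ Δ₂) D w
  | .with_ B C => HSeq Γ ((B, u) ::ₘ Δ) D w ∨ HSeq Γ ((C, u) ::ₘ Δ) D w
  | .top => False
  | .plus B C => HSeq Γ ((B, u) ::ₘ Δ) D w ∧ HSeq Γ ((C, u) ::ₘ Δ) D w
  | .zero => True
  | .bang B => HSeq (insert (B, u) Γ) Δ D w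
  | .allT B => ∃ t, HSeq Γ ((B t, u) ::ₘ Δ) D w
  | .exT B => ∀ t, HSeq Γ ((B t, u) ::ₘ Δ) D w
  | .allW B => ∃ v, HSeq Γ ((B v, u) ::ₘ Δ) D w
  | .exW B => ∀ v, HSeq Γ ((B v, u) ::ₘ Δ) D w
  | .att B v => HSeq Γ ((B, v) ::ₘ Δ) D w
  | .down B => HSeq Γ ((B u, u) ::ₘ Δ) D w

theorem RightPremises.mono {Γ Γ' : Set (Jdg W A T)} {Δ : Multiset (Jdg W A T)} {B : HF W A T}
    {u : W} (h : RightPremises Γ Δ B u) (hΓ : Γ ⊆ Γ') : RightPremises Γ' Δ B u := by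
  cases B with
  | atom | one | top | zero => exact h
  | tens =>
    obtain ⟨Δ₁, Δ₂, e, h₁, h₂⟩ := h
    exact ⟨Δ₁, Δ₂, e, h₁.mono hΓ, h₂.mono hΓ⟩
  | limp | att | down => exact HSeq.mono h hΓ
  | with_ => exact ⟨h.1.mono hΓ, h.2.mono hΓ⟩
  | plus => exact h.imp (·.mono hΓ) (·.mono hΓ)
  | bang => exact ⟨h.1, h.2.mono hΓ⟩
  | allT | allW => exact fun t => (h t).mono hΓ
  | exT | exW =>
    obtain ⟨t, h⟩ := h
    exact ⟨t, h.mono hΓ⟩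

/-- The cut on `B @ u` is admissible. -/
def CutAdmissible (B : HF W A T) (u : W) : Prop :=
  ∀ ⦃Γ Δ Δ' C w⦄, HSeq Γ Δ B u → HSeq Γ ((B, u) ::ₘ Δ') C w → HSeq Γ (Δ + Δ') C w

/-- The cut on `B @ u` is admissible when `B @ u` is principal in both premises. -/
def PrincipalCutAdmissible (B : HF W A T) (u : W) : Prop :=
  ∀ ⦃Γ Δ Δ' C w⦄, RightPremises Γ Δ B u → LeftPremises Γ Δ' B u C w → HSeq Γ (Δ + Δ') C w

theorem _root_.Multiset.add_eq_cons {α : Type*} {s t r : Multiset α} {a : α}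
    (h : s + t = a ::ₘ r) :
    (∃ s', s = a ::ₘ s' ∧ r = s' + t) ∨ ∃ t', t = a ::ₘ t' ∧ r = s + t' := by
  have ha : a ∈ s + t := h ▸ Multiset.mem_cons_self a r
  rcases Multiset.mem_add.1 ha with hs | ht
  · obtain ⟨s', rfl⟩ := Multiset.exists_cons_of_mem hs
    rw [Multiset.cons_add, Multiset.cons_inj_right] at h
    exact .inl ⟨s', rfl, h.symm⟩
  · obtain ⟨t', rfl⟩ := Multiset.exists_cons_of_mem ht
    rw [Multiset.add_cons, Multiset.cons_inj_right] at h
    exact .inr ⟨t', rfl, h.symm⟩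

/-- A judgment in a context with a distinguished judgment is either the distinguished one or
lies in the rest. -/
theorem cons_eq_cons_cases {X B : HF W A T} {v u : W} {Δ Δ' : Multiset (Jdg W A T)}
    (h : (X, v) ::ₘ Δ = (B, u) ::ₘ Δ') :
    (B = X ∧ u = v ∧ Δ' = Δ) ∨ ∃ Θ, Δ = (B, u) ::ₘ Θ ∧ Δ' = (X, v) ::ₘ Θ := by
  rcases Multiset.cons_eq_cons.1 h with ⟨e, rfl⟩ | ⟨-, h⟩
  · obtain ⟨rfl, rfl⟩ := Prod.mk.inj e
    exact .inl ⟨rfl, rfl, rfl⟩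
  · exact .inr h

/-- Cut with a premise ending in a right rule: permute the cut upwards in the other premise. -/
theorem PrincipalCutAdmissible.cut_of_rightPremises {B : HF W A T} {u : W}
    (hp : PrincipalCutAdmissible B u) {Γ : Set (Jdg W A T)} {Δ Δ' : Multiset (Jdg W A T)}
    {C : HF W A T} {w : W} (h₁ : RightPremises Γ Δ B u) (h₂ : HSeq Γ ((B, u) ::ₘ Δ') C w) :
    HSeq Γ (Δ + Δ') C w := by
  generalize hM : (B, u) ::ₘ Δ' = M at h₂
  induction h₂ generalizing Δ' with
  | init Γ a ts w =>
    obtain ⟨rfl, rfl, rfl⟩ | ⟨Θ, e, -⟩ := cons_eq_cons_cases hM.symm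
    · exact hp h₁ ⟨rfl, rfl, rfl⟩
    · exact absurd e.symm Multiset.cons_ne_zero
  | copy hm _ ih =>
    subst hM
    exact .copy hm ((ih h₁ (Multiset.cons_swap ..)).congr_ctx (Multiset.add_cons ..))
  | tensR d₁ d₂ ih₁ ih₂ =>
    rcases Multiset.add_eq_cons hM.symm with ⟨Θ, rfl, rfl⟩ | ⟨Θ, rfl, rfl⟩
    · exact (HSeq.tensR (ih₁ h₁ rfl) d₂).congr_ctx (add_assoc ..)
    · exact (HSeq.tensR d₁ (ih₂ h₁ rfl)).congr_ctx (add_left_comm ..)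
  | oneR | bangR => exact absurd hM (Multiset.cons_ne_zero)
  | limpL d₁ d₂ ih₁ ih₂ =>
    rcases cons_eq_cons_cases hM.symm with ⟨rfl, rfl, rfl⟩ | ⟨Θ, e, rfl⟩
    · exact hp h₁ ⟨_, _, rfl, d₁, d₂⟩
    · rcases Multiset.add_eq_cons e with ⟨Θ, rfl, rfl⟩ | ⟨Θ, rfl, rfl⟩
      · exact (HSeq.limpL (ih₁ h₁ rfl) d₂).congr_ctx (by rw [Multiset.add_cons, add_assoc])
      · exact (HSeq.limpL d₁ ((ih₂ h₁ (Multiset.cons_swap ..)).congr_ctx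
          (Multiset.add_cons ..))).congr_ctx (by rw [Multiset.add_cons, add_left_comm])
  | topR => exact .topR ..
  | limpR _ ih =>
    subst hM
    exact .limpR ((ih h₁ (Multiset.cons_swap ..)).congr_ctx (Multiset.add_cons ..))
  | withR _ _ ih₁ ih₂ =>
    subst hM
    exact .withR (ih₁ h₁ rfl) (ih₂ h₁ rfl)
  | plusR1 _ ih =>
    subst hM
    exact .plusR1 (ih h₁ rfl)
  | plusR2 _ ih =>
    subst hM
    exact .plusR2 (ih h₁ rfl)
  | allTR _ ih =>
    subst hM
    exact .allTR fun t => ih t h₁ rfl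
  | exTR t _ ih =>
    subst hM
    exact .exTR t (ih h₁ rfl)
  | allWR _ ih =>
    subst hM
    exact .allWR fun v => ih v h₁ rfl
  | exWR v _ ih =>
    subst hM
    exact .exWR v (ih h₁ rfl)
  | attR _ ih =>
    subst hM
    exact .attR (ih h₁ rfl)
  | downR _ ih =>
    subst hM
    exact .downR (ih h₁ rfl)
  | @tensL _ _ X Y v _ _ d ih =>
    rcases cons_eq_cons_cases hM.symm with ⟨rfl, rfl, rfl⟩ | ⟨Θ, rfl, rfl⟩
    · exact hp h₁ d
    · rw [Multiset.add_cons]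
      exact .tensL ((ih (Δ' := (X, v) ::ₘ (Y, v) ::ₘ Θ) h₁
        (by rw [Multiset.cons_swap (B, u), Multiset.cons_swap (B, u)])).congr_ctx
        (by rw [Multiset.add_cons, Multiset.add_cons]))
  | oneL d ih =>
    rcases cons_eq_cons_cases hM.symm with ⟨rfl, rfl, rfl⟩ | ⟨Θ, rfl, rfl⟩
    · exact hp h₁ d
    · rw [Multiset.add_cons]
      exact .oneL (ih h₁ rfl)
  | withL1 d ih =>
    rcases cons_eq_cons_cases hM.symm with ⟨rfl, rfl, rfl⟩ | ⟨Θ, rfl, rfl⟩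
    · exact hp h₁ (.inl d)
    · rw [Multiset.add_cons]
      exact .withL1 ((ih h₁ (Multiset.cons_swap ..)).congr_ctx (Multiset.add_cons ..))
  | withL2 d ih =>
    rcases cons_eq_cons_cases hM.symm with ⟨rfl, rfl, rfl⟩ | ⟨Θ, rfl, rfl⟩
    · exact hp h₁ (.inr d)
    · rw [Multiset.add_cons]
      exact .withL2 ((ih h₁ (Multiset.cons_swap ..)).congr_ctx (Multiset.add_cons ..))
  | plusL d₁ d₂ ih₁ ih₂ =>
    rcases cons_eq_cons_cases hM.symm with ⟨rfl, rfl, rfl⟩ | ⟨Θ, rfl, rfl⟩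
    · exact hp h₁ ⟨d₁, d₂⟩
    · rw [Multiset.add_cons]
      exact .plusL ((ih₁ h₁ (Multiset.cons_swap ..)).congr_ctx (Multiset.add_cons ..))
        ((ih₂ h₁ (Multiset.cons_swap ..)).congr_ctx (Multiset.add_cons ..))
  | zeroL =>
    rcases cons_eq_cons_cases hM.symm with ⟨rfl, rfl, rfl⟩ | ⟨Θ, rfl, rfl⟩
    · exact hp h₁ trivial
    · rw [Multiset.add_cons]
      exact .zeroL ..
  | bangL d ih =>
    rcases cons_eq_cons_cases hM.symm with ⟨rfl, rfl, rfl⟩ | ⟨Θ, rfl, rfl⟩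
    · exact hp h₁ d
    · rw [Multiset.add_cons]
      exact .bangL (ih (h₁.mono (Set.subset_insert ..)) rfl)
  | allTL t d ih =>
    rcases cons_eq_cons_cases hM.symm with ⟨rfl, rfl, rfl⟩ | ⟨Θ, rfl, rfl⟩
    · exact hp h₁ ⟨t, d⟩
    · rw [Multiset.add_cons]
      exact .allTL t ((ih h₁ (Multiset.cons_swap ..)).congr_ctx (Multiset.add_cons ..))
  | exTL d ih =>
    rcases cons_eq_cons_cases hM.symm with ⟨rfl, rfl, rfl⟩ | ⟨Θ, rfl, rfl⟩
    · exact hp h₁ d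
    · rw [Multiset.add_cons]
      exact .exTL fun t =>
        ((ih t h₁ (Multiset.cons_swap ..)).congr_ctx (Multiset.add_cons ..))
  | allWL v d ih =>
    rcases cons_eq_cons_cases hM.symm with ⟨rfl, rfl, rfl⟩ | ⟨Θ, rfl, rfl⟩
    · exact hp h₁ ⟨v, d⟩
    · rw [Multiset.add_cons]
      exact .allWL v ((ih h₁ (Multiset.cons_swap ..)).congr_ctx (Multiset.add_cons ..))
  | exWL d ih =>
    rcases cons_eq_cons_cases hM.symm with ⟨rfl, rfl, rfl⟩ | ⟨Θ, rfl, rfl⟩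
    · exact hp h₁ d
    · rw [Multiset.add_cons]
      exact .exWL fun v =>
        ((ih v h₁ (Multiset.cons_swap ..)).congr_ctx (Multiset.add_cons ..))
  | attL d ih =>
    rcases cons_eq_cons_cases hM.symm with ⟨rfl, rfl, rfl⟩ | ⟨Θ, rfl, rfl⟩
    · exact hp h₁ d
    · rw [Multiset.add_cons]
      exact .attL ((ih h₁ (Multiset.cons_swap ..)).congr_ctx (Multiset.add_cons ..))
  | downL d ih =>
    rcases cons_eq_cons_cases hM.symm with ⟨rfl, rfl, rfl⟩ | ⟨Θ, rfl, rfl⟩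
    · exact hp h₁ d
    · rw [Multiset.add_cons]
      exact .downL ((ih h₁ (Multiset.cons_swap ..)).congr_ctx (Multiset.add_cons ..))

/-- Permute the cut upwards in the premise proving the cut judgment. -/
theorem PrincipalCutAdmissible.cutAdmissible {B : HF W A T} {u : W}
    (hp : PrincipalCutAdmissible B u) : CutAdmissible B u := by
  intro Γ Δ Δ' D w h₁ h₂
  induction h₁ with
  | copy hm _ ih => exact .copy hm ((ih hp h₂).congr_ctx (Multiset.cons_add ..))
  | init => exact hp.cut_of_rightPremises rfl h₂
  | tensR d₁ d₂ => exact hp.cut_of_rightPremises ⟨_, _, rfl, d₁, d₂⟩ h₂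
  | oneR => exact hp.cut_of_rightPremises rfl h₂
  | limpR d => exact hp.cut_of_rightPremises d h₂
  | withR d₁ d₂ => exact hp.cut_of_rightPremises ⟨d₁, d₂⟩ h₂
  | topR => exact hp.cut_of_rightPremises trivial h₂
  | plusR1 d => exact hp.cut_of_rightPremises (.inl d) h₂
  | plusR2 d => exact hp.cut_of_rightPremises (.inr d) h₂
  | bangR d => exact hp.cut_of_rightPremises ⟨rfl, d⟩ h₂
  | allTR d => exact hp.cut_of_rightPremises d h₂
  | exTR t d => exact hp.cut_of_rightPremises ⟨t, d⟩ h₂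
  | allWR d => exact hp.cut_of_rightPremises d h₂
  | exWR v d => exact hp.cut_of_rightPremises ⟨v, d⟩ h₂
  | attR d => exact hp.cut_of_rightPremises d h₂
  | downR d => exact hp.cut_of_rightPremises d h₂
  | tensL _ ih =>
    rw [Multiset.cons_add]
    exact .tensL ((ih hp h₂).congr_ctx (by rw [Multiset.cons_add, Multiset.cons_add]))
  | oneL _ ih =>
    rw [Multiset.cons_add]
    exact .oneL (ih hp h₂)
  | limpL d₁ _ _ ih =>
    rw [Multiset.cons_add]
    exact (HSeq.limpL d₁ ((ih hp h₂).congr_ctx (Multiset.cons_add ..))).congr_ctx (by rw [add_assoc])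
  | withL1 _ ih =>
    rw [Multiset.cons_add]
    exact .withL1 ((ih hp h₂).congr_ctx (Multiset.cons_add ..))
  | withL2 _ ih =>
    rw [Multiset.cons_add]
    exact .withL2 ((ih hp h₂).congr_ctx (Multiset.cons_add ..))
  | plusL _ _ ih₁ ih₂ =>
    rw [Multiset.cons_add]
    exact .plusL ((ih₁ hp h₂).congr_ctx (Multiset.cons_add ..))
      ((ih₂ hp h₂).congr_ctx (Multiset.cons_add ..))
  | zeroL =>
    rw [Multiset.cons_add]
    exact .zeroL ..
  | bangL _ ih =>
    rw [Multiset.cons_add]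
    exact .bangL (ih hp (h₂.mono (Set.subset_insert ..)))
  | allTL t _ ih =>
    rw [Multiset.cons_add]
    exact .allTL t ((ih hp h₂).congr_ctx (Multiset.cons_add ..))
  | exTL _ ih =>
    rw [Multiset.cons_add]
    exact .exTL fun t => ((ih t hp h₂).congr_ctx (Multiset.cons_add ..))
  | allWL v _ ih =>
    rw [Multiset.cons_add]
    exact .allWL v ((ih hp h₂).congr_ctx (Multiset.cons_add ..))
  | exWL _ ih =>
    rw [Multiset.cons_add]
    exact .exWL fun v => ((ih v hp h₂).congr_ctx (Multiset.cons_add ..))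
  | attL _ ih =>
    rw [Multiset.cons_add]
    exact .attL ((ih hp h₂).congr_ctx (Multiset.cons_add ..))
  | downL _ ih =>
    rw [Multiset.cons_add]
    exact .downL ((ih hp h₂).congr_ctx (Multiset.cons_add ..))

/-- Cut of a judgment in the unbounded context. -/
theorem CutAdmissible.cut_unbounded {B : HF W A T} {u : W} (hB : CutAdmissible B u)
    {Γ : Set (Jdg W A T)} {Δ : Multiset (Jdg W A T)} {C : HF W A T} {w : W}
    (h₁ : HSeq Γ 0 B u) (h₂ : HSeq (insert (B, u) Γ) Δ C w) : HSeq Γ Δ C w := by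
  generalize hΓ : insert (B, u) Γ = Γ' at h₂
  induction h₂ generalizing Γ with
  | init => exact .init ..
  | copy hm _ ih =>
    subst hΓ
    rcases hm with hm | hm
    · obtain ⟨rfl, rfl⟩ := Prod.mk.inj hm
      exact (hB h₁ (ih h₁ rfl)).congr_ctx (zero_add _)
    · exact .copy hm (ih h₁ rfl)
  | bangL _ ih =>
    subst hΓ
    exact .bangL (ih (h₁.mono (Set.subset_insert ..)) (Set.insert_comm ..))
  | tensR _ _ ih₁ ih₂ => exact .tensR (ih₁ h₁ hΓ) (ih₂ h₁ hΓ)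
  | tensL _ ih => exact .tensL (ih h₁ hΓ)
  | oneR => exact .oneR ..
  | oneL _ ih => exact .oneL (ih h₁ hΓ)
  | limpR _ ih => exact .limpR (ih h₁ hΓ)
  | limpL _ _ ih₁ ih₂ => exact .limpL (ih₁ h₁ hΓ) (ih₂ h₁ hΓ)
  | withR _ _ ih₁ ih₂ => exact .withR (ih₁ h₁ hΓ) (ih₂ h₁ hΓ)
  | withL1 _ ih => exact .withL1 (ih h₁ hΓ)
  | withL2 _ ih => exact .withL2 (ih h₁ hΓ)
  | topR => exact .topR ..
  | plusR1 _ ih => exact .plusR1 (ih h₁ hΓ)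
  | plusR2 _ ih => exact .plusR2 (ih h₁ hΓ)
  | plusL _ _ ih₁ ih₂ => exact .plusL (ih₁ h₁ hΓ) (ih₂ h₁ hΓ)
  | zeroL => exact .zeroL ..
  | bangR _ ih => exact .bangR (ih h₁ hΓ)
  | allTR _ ih => exact .allTR fun t => ih t h₁ hΓ
  | allTL t _ ih => exact .allTL t (ih h₁ hΓ)
  | exTR t _ ih => exact .exTR t (ih h₁ hΓ)
  | exTL _ ih => exact .exTL fun t => ih t h₁ hΓ
  | allWR _ ih => exact .allWR fun v => ih v h₁ hΓ
  | allWL v _ ih => exact .allWL v (ih h₁ hΓ)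
  | exWR v _ ih => exact .exWR v (ih h₁ hΓ)
  | exWL _ ih => exact .exWL fun v => ih v h₁ hΓ
  | attR _ ih => exact .attR (ih h₁ hΓ)
  | attL _ ih => exact .attL (ih h₁ hΓ)
  | downR _ ih => exact .downR (ih h₁ hΓ)
  | downL _ ih => exact .downL (ih h₁ hΓ)

theorem cutAdmissible (B : HF W A T) (u : W) : CutAdmissible B u := by
  induction B generalizing u with
  | atom =>
    refine PrincipalCutAdmissible.cutAdmissible ?_
    rintro Γ Δ Δ' D w rfl ⟨rfl, rfl, rfl⟩
    exact .init ..
  | tens B C ihB ihC =>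
    refine PrincipalCutAdmissible.cutAdmissible ?_
    rintro Γ _ Δ' D w ⟨Δ₁, Δ₂, rfl, d₁, d₂⟩ h
    exact (ihC u d₂ ((ihB u d₁ h).congr_ctx (Multiset.add_cons ..))).congr_ctx
      (by rw [add_assoc, add_left_comm])
  | one =>
    refine PrincipalCutAdmissible.cutAdmissible ?_
    rintro Γ _ Δ' D w rfl h
    exact HSeq.congr_ctx h (zero_add _).symm
  | limp B C ihB ihC =>
    refine PrincipalCutAdmissible.cutAdmissible ?_
    rintro Γ Δ _ D w h ⟨Δ₁, Δ₂, rfl, d₁, d₂⟩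
    exact (ihC u (ihB u d₁ h) d₂).congr_ctx (by rw [add_assoc, add_left_comm])
  | with_ B C ihB ihC =>
    refine PrincipalCutAdmissible.cutAdmissible ?_
    rintro Γ Δ Δ' D w ⟨d₁, d₂⟩ (h | h)
    exacts [ihB u d₁ h, ihC u d₂ h]
  | top => exact PrincipalCutAdmissible.cutAdmissible fun _ _ _ _ _ _ h => h.elim
  | plus B C ihB ihC =>
    refine PrincipalCutAdmissible.cutAdmissible ?_
    rintro Γ Δ Δ' D w (d | d) ⟨h₁, h₂⟩
    exacts [ihB u d h₁, ihC u d h₂]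
  | zero => exact PrincipalCutAdmissible.cutAdmissible fun _ _ _ _ _ h => h.elim
  | bang B ih =>
    refine PrincipalCutAdmissible.cutAdmissible ?_
    rintro Γ _ Δ' D w ⟨rfl, d⟩ h
    exact ((ih u).cut_unbounded d h).congr_ctx (zero_add _).symm
  | allT B ih | allW B ih =>
    refine PrincipalCutAdmissible.cutAdmissible ?_
    rintro Γ Δ Δ' D w d ⟨t, h⟩
    exact ih t u (d t) h
  | exT B ih | exW B ih =>
    refine PrincipalCutAdmissible.cutAdmissible ?_
    rintro Γ Δ Δ' D w ⟨t, d⟩ h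
    exact ih t u d (h t)
  | att B v ih => exact PrincipalCutAdmissible.cutAdmissible fun _ _ _ _ _ d h => ih v d h
  | down B ih => exact PrincipalCutAdmissible.cutAdmissible fun _ _ _ _ _ d h => ih u u d h

end HyLL

/-- **Cut admissibility for HyLL (linear cut).**  If `Γ; Δ ⊢ A @ u` and
`Γ; Δ', A @ u ⊢ C @ w` are derivable in HyLL, then so is `Γ; Δ, Δ' ⊢ C @ w`. -/
theorem hyll_cut_linear {W A T : Type} [Monoid W]
    (Γ : Set (HyLL.Jdg W A T)) (Δ Δ' : Multiset (HyLL.Jdg W A T))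
    (B C : HyLL.HF W A T) (u w : W)
    (h₁ : HyLL.HSeq Γ Δ B u)
    (h₂ : HyLL.HSeq Γ ((B, u) ::ₘ Δ') C w) :
    HyLL.HSeq Γ (Δ + Δ') C w := by
  exact HyLL.cutAdmissible B u h₁ h₂
end

section
/- (Information confinement in SELL, local inconsistency) Let Σ = ⟨I, ≼, U⟩ be a subexponential signature and w ∈ I. The two-sided SELL sequent !ʷ?ʷ0 ⊢ 0 is not provable in SELL; equivalently, the one-sided sequent ⊢ (!ʷ?ʷ0)⊥, 0, i.e. ⊢ ?ʷ!ʷ⊤, 0, is not provable in SELL. -/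
/-!
SELL: classical first-order linear logic with subexponentials `!ᵃ`, `?ᵃ`
indexed by a subexponential signature `Σ = ⟨I, ≼, U⟩`.  One-sided sequents.
A two-sided sequent `Δ ⊢ G` abbreviates the one-sided sequent `⊢ Δ⊥, G`.
-/

namespace SELL

/-- A subexponential signature `Σ = ⟨I, ≼, U⟩`: a preorder `≼` on the labels `I`
and an upwardly closed set `U ⊆ I` of unbounded labels. -/
structure Sig (I : Type) where
  le : I → I → Prop
  le_refl : ∀ a, le a a
  le_trans : ∀ a b c, le a b → le b c → le a c
  U : Set I
  U_up : ∀ a b, a ∈ U → le a b → b ∈ U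

/-- Formulas of SELL over labels `I`, atoms `A` and first-order terms `T`. -/
inductive SF (I A T : Type) : Type where
  | pos : A → SF I A T
  | neg : A → SF I A T
  | tens : SF I A T → SF I A T → SF I A T
  | parr : SF I A T → SF I A T → SF I A T
  | plus : SF I A T → SF I A T → SF I A T
  | with_ : SF I A T → SF I A T → SF I A T
  | one : SF I A T
  | bot : SF I A T
  | top : SF I A T
  | zero : SF I A T
  | all : (T → SF I A T) → SF I A T
  | ex : (T → SF I A T) → SF I A T
  | bang : I → SF I A T → SF I A T
  | quest : I → SF I A T → SF I A T

variable {I A T : Type}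

/-- The involutive De Morgan negation, exchanging `⊗/⅋`, `⊕/&`, `1/⊥`, `⊤/0`,
`∀/∃` and `!ᵃ/?ᵃ`. -/
def SF.dual : SF I A T → SF I A T
  | pos a => neg a
  | neg a => pos a
  | tens B C => parr B.dual C.dual
  | parr B C => tens B.dual C.dual
  | plus B C => with_ B.dual C.dual
  | with_ B C => plus B.dual C.dual
  | one => bot
  | bot => one
  | top => zero
  | zero => top
  | all B => ex fun t => (B t).dual
  | ex B => all fun t => (B t).dual
  | bang i B => quest i B.dual
  | quest i B => bang i B.dual

/-- Derivability of one-sided SELL sequents `⊢ Γ`: the standard one-sided MALL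
rules, dereliction, promotion (`!ᵃG` from a context all of whose formulas are
`?ᵇ`-marked with `a ≼ b`), and weakening/contraction for `?ᵃ` with `a ∈ U`. -/
inductive Seq (σ : Sig I) : Multiset (SF I A T) → Prop where
  | init (a : A) : Seq σ {.pos a, .neg a}
  | tens {Γ Δ B C} : Seq σ (B ::ₘ Γ) → Seq σ (C ::ₘ Δ) →
      Seq σ (.tens B C ::ₘ (Γ + Δ))
  | parr {Γ B C} : Seq σ (B ::ₘ C ::ₘ Γ) → Seq σ (.parr B C ::ₘ Γ)
  | plus1 {Γ B C} : Seq σ (B ::ₘ Γ) → Seq σ (.plus B C ::ₘ Γ)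
  | plus2 {Γ B C} : Seq σ (C ::ₘ Γ) → Seq σ (.plus B C ::ₘ Γ)
  | with_ {Γ B C} : Seq σ (B ::ₘ Γ) → Seq σ (C ::ₘ Γ) → Seq σ (.with_ B C ::ₘ Γ)
  | one : Seq σ {.one}
  | bot {Γ} : Seq σ Γ → Seq σ (.bot ::ₘ Γ)
  | top (Γ) : Seq σ (.top ::ₘ Γ)
  | all {Γ B} : (∀ t : T, Seq σ (B t ::ₘ Γ)) → Seq σ (.all B ::ₘ Γ)
  | ex {Γ B} (t : T) : Seq σ (B t ::ₘ Γ) → Seq σ (.ex B ::ₘ Γ)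
  | quest {Γ a B} : Seq σ (B ::ₘ Γ) → Seq σ (.quest a B ::ₘ Γ)
  | bang {Γ a B} : (∀ F ∈ Γ, ∃ b C, F = SF.quest b C ∧ σ.le a b) →
      Seq σ (B ::ₘ Γ) → Seq σ (.bang a B ::ₘ Γ)
  | weak {Γ a B} : a ∈ σ.U → Seq σ Γ → Seq σ (.quest a B ::ₘ Γ)
  | contr {Γ a B} : a ∈ σ.U → Seq σ (.quest a B ::ₘ .quest a B ::ₘ Γ) →
      Seq σ (.quest a B ::ₘ Γ)

end SELL

namespace SELL

variable {I A T : Type}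

/-- A sequent containing `0` whose other formulas are all `?ʷ!ʷ⊤` or `!ʷ⊤` is underivable:
promotion is blocked by `0`, and no other rule can remove it. -/
theorem Seq.false_of_zero_mem {σ : Sig I} {w : I} {Γ : Multiset (SF I A T)} (h : Seq σ Γ)
    (h_zero : SF.zero ∈ Γ)
    (h_mem : ∀ F ∈ Γ, F = .zero ∨ F = .quest w (.bang w .top) ∨ F = .bang w .top) : False := by
  induction h with
  | bang h_ctx _ _ =>
    obtain ⟨b, C, h_eq, _⟩ := h_ctx SF.zero (by simpa using h_zero)
    cases h_eq
  | _ => simp_all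

end SELL

/-- **Information confinement in SELL (local inconsistency).**  For any
subexponential signature `Σ` and any label `w`, the two-sided SELL sequent
`!ʷ?ʷ0 ⊢ 0` is not provable, i.e. the one-sided sequent `⊢ ?ʷ!ʷ⊤, 0`
(the negation of `!ʷ?ʷ0` together with `0`) is not provable in SELL. -/
theorem sell_confinement_local {I A T : Type} (σ : SELL.Sig I) (w : I) :
    ¬ SELL.Seq σ ({.quest w (.bang w .top), .zero} : Multiset (SELL.SF I A T)) := by
  intro h
  exact h.false_of_zero_mem (w := w) (by simp) (by simp)
end

section
/- (Information confinement in SELL, non-propagation of inconsistency) Let Σ = ⟨I, ≼, U⟩ be a subexponential signature and let w, v ∈ I be incomparable labels (w ⋠ v and v ⋠ w). The two-sided SELL sequent !ʷ?ʷ0 ⊢ !ᵛ?ᵛ0 is not provable in SELL; equivalently, the one-sided sequent ⊢ ?ʷ!ʷ⊤, !ᵛ?ᵛ0 is not provable in SELL. -/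
namespace SELL

variable {I A T : Type}

/-- A sequent made only of copies of `?ᵛ0` and `0` is not derivable. -/
theorem Seq.not_forall_quest_zero_or_zero {σ : Sig I} {Γ : Multiset (SF I A T)} (v : I)
    (h : Seq σ Γ) : ¬ ∀ F ∈ Γ, F = .quest v .zero ∨ F = .zero := by
  induction h <;> intro hΓ <;> simp_all

/-- If `v ⋠ w`, a sequent made only of copies of `?ʷ!ʷ⊤`, `!ʷ⊤` and `!ᵛ?ᵛ0`, with at least one
copy of `!ᵛ?ᵛ0`, is not derivable. -/
theorem Seq.not_forall_of_bang_quest_zero_mem {σ : Sig I} {Γ : Multiset (SF I A T)} {w v : I}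
    (hvw : ¬ σ.le v w) (h : Seq σ Γ) (hN : SF.bang v (.quest v .zero) ∈ Γ) :
    ¬ ∀ F ∈ Γ, F = .quest w (.bang w .top) ∨ F = .bang w .top ∨
      F = .bang v (.quest v .zero) := by
  induction h with
  | @bang Γ a B hctx hB _ =>
    intro hΓ
    rcases Multiset.mem_cons.1 hN with hN | hN
    · obtain ⟨rfl, rfl⟩ := SF.bang.inj hN
      refine hB.not_forall_quest_zero_or_zero v fun F hF => ?_
      rcases Multiset.mem_cons.1 hF with rfl | hF
      · exact .inl rfl
      · obtain ⟨b, C, rfl, hb⟩ := hctx F hF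
        have hQ := hΓ _ (Multiset.mem_cons_of_mem hF)
        simp only [SF.quest.injEq, reduceCtorEq, or_false] at hQ
        exact absurd (hQ.1 ▸ hb) hvw
    · obtain ⟨b, C, hC, _⟩ := hctx _ hN
      cases hC
  | _ => intro hΓ; simp_all

end SELL

/-- **Information confinement in SELL (non-propagation of inconsistency).**
For any subexponential signature `Σ` and incomparable labels `w`, `v`
(`w ⋠ v` and `v ⋠ w`), the two-sided SELL sequent `!ʷ?ʷ0 ⊢ !ᵛ?ᵛ0` is not
provable, i.e. the one-sided sequent `⊢ ?ʷ!ʷ⊤, !ᵛ?ᵛ0` is not provable in SELL. -/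
theorem sell_confinement_no_propagation {I A T : Type} (σ : SELL.Sig I) (w v : I)
    (hwv : ¬ σ.le w v) (hvw : ¬ σ.le v w) :
    ¬ SELL.Seq σ
      ({.quest w (.bang w .top), .bang v (.quest v .zero)} : Multiset (SELL.SF I A T)) := by
  intro h
  exact h.not_forall_of_bang_quest_zero_mem hvw (by simp) (by simp)
end

section
/- (Firability tests in MALL) Let V = {a₁, …, aₙ} be a finite set of propositional variables and let s, s' be two distinct states on V. Then: (i) the sequents ⊢ ⟦s⟧, test⁺(s) and ⊢ ⟦s⟧, test⁻(s') are both provable in MALL; and (ii) the sequents ⊢ ⟦s⟧, test⁻(s) and ⊢ ⟦s⟧, test⁺(s') are not provable in MALL. -/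
/-!
μMALL: one-sided multiplicative-additive linear logic over the literals
`aᵢ`, `aᵢ⊥` (`i : Fin n`), extended with least and greatest fixed point
operators `μ` and `ν` (fixed point variables in de Bruijn style), and the
encoding of transition systems and CTL formulas.
-/

namespace MuMALL

/-- Formulas of μMALL: literals, MALL connectives, fixed point variables
(de Bruijn indices) and the fixed point operators `μ`, `ν`. -/
inductive MF (n : ℕ) : Type where
  | pos : Fin n → MF n
  | neg : Fin n → MF n
  | var : ℕ → MF n
  | tens : MF n → MF n → MF n
  | parr : MF n → MF n → MF n
  | plus : MF n → MF n → MF n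
  | witha : MF n → MF n → MF n
  | one : MF n
  | bot : MF n
  | top : MF n
  | zero : MF n
  | mu : MF n → MF n
  | nu : MF n → MF n

variable {n : ℕ}

/-- Involutive De Morgan negation (`μ/ν` dual, fixed point variables fixed). -/
def MF.dual : MF n → MF n
  | pos a => neg a
  | neg a => pos a
  | var i => var i
  | tens B C => parr B.dual C.dual
  | parr B C => tens B.dual C.dual
  | plus B C => witha B.dual C.dual
  | witha B C => plus B.dual C.dual
  | one => bot
  | bot => one
  | top => zero
  | zero => top
  | mu B => nu B.dual
  | nu B => mu B.dual

/-- `B.subst C k`: substitution of the closed formula `C` for the fixed point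
variable `k` in `B` (de Bruijn indices are shifted under the binders `μ`, `ν`). -/
def MF.subst : MF n → MF n → ℕ → MF n
  | .pos a, _, _ => .pos a
  | .neg a, _, _ => .neg a
  | .var i, C, k => if i = k then C else .var i
  | .tens B D, C, k => .tens (B.subst C k) (D.subst C k)
  | .parr B D, C, k => .parr (B.subst C k) (D.subst C k)
  | .plus B D, C, k => .plus (B.subst C k) (D.subst C k)
  | .witha B D, C, k => .witha (B.subst C k) (D.subst C k)
  | .one, _, _ => .one
  | .bot, _, _ => .bot
  | .top, _, _ => .top
  | .zero, _, _ => .zero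
  | .mu B, C, k => .mu (B.subst C (k + 1))
  | .nu B, C, k => .nu (B.subst C (k + 1))

/-- Derivability of one-sided μMALL sequents `⊢ Γ`: the standard MALL rules,
the unfolding rule for `μ` (from `⊢ Δ, B(μB)` infer `⊢ Δ, μB`) and the
coinduction rule for `ν` (from `⊢ Δ, S` and `⊢ B S, S⊥` infer `⊢ Δ, νB`,
where `S` is the coinductive invariant). -/
inductive MSeq : Multiset (MF n) → Prop where
  | init (a : Fin n) : MSeq {.pos a, .neg a}
  | tens {Γ Δ B C} : MSeq (B ::ₘ Γ) → MSeq (C ::ₘ Δ) →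
      MSeq (.tens B C ::ₘ (Γ + Δ))
  | parr {Γ B C} : MSeq (B ::ₘ C ::ₘ Γ) → MSeq (.parr B C ::ₘ Γ)
  | plus1 {Γ B C} : MSeq (B ::ₘ Γ) → MSeq (.plus B C ::ₘ Γ)
  | plus2 {Γ B C} : MSeq (C ::ₘ Γ) → MSeq (.plus B C ::ₘ Γ)
  | witha {Γ B C} : MSeq (B ::ₘ Γ) → MSeq (C ::ₘ Γ) → MSeq (.witha B C ::ₘ Γ)
  | one : MSeq {.one}
  | bot {Γ} : MSeq Γ → MSeq (.bot ::ₘ Γ)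
  | top (Γ) : MSeq (.top ::ₘ Γ)
  | mu {Γ B} : MSeq (B.subst (.mu B) 0 ::ₘ Γ) → MSeq (.mu B ::ₘ Γ)
  | nu {Γ B} (S : MF n) : MSeq (S ::ₘ Γ) → MSeq {B.subst S 0, S.dual} →
      MSeq (.nu B ::ₘ Γ)

/-- A state on the variables `a₁, …, aₙ`: a valuation `Fin n → Bool`. -/
abbrev State (n : ℕ) := Fin n → Bool

/-- A transition rule `r : s → s'`. -/
abbrev Rule (n : ℕ) := State n × State n

/-- `⟦pᵢ(aᵢ)⟧`: `⟦pres(aᵢ)⟧ = aᵢ`, `⟦abs(aᵢ)⟧ = aᵢ⊥`. -/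
def lit (b : Bool) (i : Fin n) : MF n := if b then .pos i else .neg i

/-- `⟦pᵢ(aᵢ)⟧⊥`. -/
def dlit (b : Bool) (i : Fin n) : MF n := if b then .neg i else .pos i

/-- `⟦s⟧ = ⟦p₁(a₁)⟧⊥ ⅋ … ⅋ ⟦pₙ(aₙ)⟧⊥`. -/
def encS (s : State n) : MF n :=
  (List.finRange n).foldr (fun i G => .parr (dlit (s i) i) G) .bot

/-- `test⁺(s) = ⟦p₁(a₁)⟧ ⊗ … ⊗ ⟦pₙ(aₙ)⟧ = ⟦s⟧⊥`. -/
def testP (s : State n) : MF n :=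
  (List.finRange n).foldr (fun i G => .tens (lit (s i) i) G) .one

/-- `test⁻(s) = (⟦p₁(a₁)⟧⊥ ⊗ ⊤) ⊕ … ⊕ (⟦pₙ(aₙ)⟧⊥ ⊗ ⊤)`. -/
def testN (s : State n) : MF n :=
  (List.finRange n).foldr (fun i G => .plus (.tens (dlit (s i) i) .top) G) .zero

/-- Finite additive conjunction `&`. -/
def bigWith (l : List (MF n)) : MF n := l.foldr .witha .top

/-- Finite additive disjunction `⊕`. -/
def bigPlus (l : List (MF n)) : MF n := l.foldr .plus .zero

/-- `&_{s→s'∈R} (test⁻(s) ⊕ (test⁺(s) ⊗ (⟦s'⟧ ⅋ Y)))`. -/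
def encA (R : List (Rule n)) (Y : MF n) : MF n :=
  bigWith (R.map fun r => .plus (testN r.1) (.tens (testP r.1) (.parr (encS r.2) Y)))

/-- `⊕_{s→s'∈R} (test⁺(s) ⊗ (⟦s'⟧ ⅋ Y))`. -/
def encE (R : List (Rule n)) (Y : MF n) : MF n :=
  bigPlus (R.map fun r => .tens (testP r.1) (.parr (encS r.2) Y))

/-- CTL formulas built from state formulas by `∧`, `∨` and the path-quantified
temporal operators `AX, EX, AF, EF, AG, EG, A[· U ·], E[· U ·]`. -/
inductive CTL (n : ℕ) : Type where
  | st : State n → CTL n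
  | and : CTL n → CTL n → CTL n
  | or : CTL n → CTL n → CTL n
  | AX : CTL n → CTL n
  | EX : CTL n → CTL n
  | AF : CTL n → CTL n
  | EF : CTL n → CTL n
  | AG : CTL n → CTL n
  | EG : CTL n → CTL n
  | AU : CTL n → CTL n → CTL n
  | EU : CTL n → CTL n → CTL n

/-- The encoding `⟦F⟧_R` of CTL formulas into μMALL (Figure 4): state formulas
as `test⁺`, `∧`/`∨` as `&`/`⊕`, and the temporal operators as the fixed point
formulas (`var 0` is the fixed point variable `Y`). -/
def encCTL (R : List (Rule n)) : CTL n → MF n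
  | .st p => testP p
  | .and F G => .witha (encCTL R F) (encCTL R G)
  | .or F G => .plus (encCTL R F) (encCTL R G)
  | .AX F => encA R (encCTL R F)
  | .EX F => encE R (encCTL R F)
  | .AF F => .mu (.plus (encCTL R F) (encA R (.var 0)))
  | .EF F => .mu (.plus (encCTL R F) (encE R (.var 0)))
  | .AG F => .nu (.witha (encCTL R F) (encA R (.var 0)))
  | .EG F => .nu (.witha (encCTL R F) (encE R (.var 0)))
  | .AU F G => .mu (.plus (encCTL R G) (.witha (encCTL R F) (encA R (.var 0))))
  | .EU F G => .mu (.plus (encCTL R G) (.witha (encCTL R F) (encE R (.var 0))))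

/-- One-step transition of the system defined by `R` (a rule `s → s'` is
fireable exactly at the state `s`). -/
def step (R : List (Rule n)) (s s' : State n) : Prop := (s, s') ∈ R

/-- An infinite path of the transition system defined by `R`. -/
def isPath (R : List (Rule n)) (π : ℕ → State n) : Prop :=
  ∀ k, step R (π k) (π (k + 1))

/-- Standard CTL satisfaction `s ⊨_R F` over the (serial) transition system
generated by `R`. -/
def sat (R : List (Rule n)) : CTL n → State n → Prop
  | .st p, s => s = p
  | .and F G, s => sat R F s ∧ sat R G s
  | .or F G, s => sat R F s ∨ sat R G s
  | .AX F, s => ∀ s', step R s s' → sat R F s'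
  | .EX F, s => ∃ s', step R s s' ∧ sat R F s'
  | .AF F, s => ∀ π, isPath R π → π 0 = s → ∃ k, sat R F (π k)
  | .EF F, s => ∃ π, isPath R π ∧ π 0 = s ∧ ∃ k, sat R F (π k)
  | .AG F, s => ∀ π, isPath R π → π 0 = s → ∀ k, sat R F (π k)
  | .EG F, s => ∃ π, isPath R π ∧ π 0 = s ∧ ∀ k, sat R F (π k)
  | .AU F G, s => ∀ π, isPath R π → π 0 = s →
      ∃ k, sat R G (π k) ∧ ∀ j < k, sat R F (π j)
  | .EU F G, s => ∃ π, isPath R π ∧ π 0 = s ∧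
      ∃ k, sat R G (π k) ∧ ∀ j < k, sat R F (π j)

end MuMALL

namespace MuMALL

/-- Derivability of one-sided MALL sequents `⊢ Γ` (no fixed point rules):
init on dual literals, `⊗`, `⅋`, `⊕ᵢ`, `&`, `1`, `⊥`, `⊤`. -/
inductive MallSeq : Multiset (MF n) → Prop where
  | init (a : Fin n) : MallSeq {.pos a, .neg a}
  | tens {Γ Δ B C} : MallSeq (B ::ₘ Γ) → MallSeq (C ::ₘ Δ) →
      MallSeq (.tens B C ::ₘ (Γ + Δ))
  | parr {Γ B C} : MallSeq (B ::ₘ C ::ₘ Γ) → MallSeq (.parr B C ::ₘ Γ)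
  | plus1 {Γ B C} : MallSeq (B ::ₘ Γ) → MallSeq (.plus B C ::ₘ Γ)
  | plus2 {Γ B C} : MallSeq (C ::ₘ Γ) → MallSeq (.plus B C ::ₘ Γ)
  | witha {Γ B C} : MallSeq (B ::ₘ Γ) → MallSeq (C ::ₘ Γ) →
      MallSeq (.witha B C ::ₘ Γ)
  | one : MallSeq {.one}
  | bot {Γ} : MallSeq Γ → MallSeq (.bot ::ₘ Γ)
  | top (Γ) : MallSeq (.top ::ₘ Γ)

end MuMALL

namespace MuMALL

/-- Classical truth of a formula under a valuation; fixed point formulas are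
assigned an arbitrary value, since they play no role in MALL. -/
def MF.eval (v : State n) : MF n → Prop
  | .pos a => v a = true
  | .neg a => v a = false
  | .tens B C => B.eval v ∧ C.eval v
  | .parr B C => B.eval v ∨ C.eval v
  | .plus B C => B.eval v ∨ C.eval v
  | .witha B C => B.eval v ∧ C.eval v
  | .one => True
  | .bot => False
  | .top => True
  | .zero => False
  | .var _ => False
  | .mu _ => False
  | .nu _ => False

/-- MALL is sound for classical truth. -/
theorem MallSeq.exists_eval (v : State n) {Γ : Multiset (MF n)} (h : MallSeq Γ) :
    ∃ F ∈ Γ, F.eval v := by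
  induction h with
  | init a => cases h : v a <;> simp [MF.eval, h]
  | tens _ _ ih₁ ih₂ =>
    simp only [Multiset.mem_cons, Multiset.mem_add, exists_eq_or_imp, MF.eval] at *
    grind
  | _ => simp_all [MF.eval] <;> grind

theorem not_eval_dlit (s : State n) (i : Fin n) : ¬ (dlit (s i) i).eval s := by
  cases h : s i <;> simp [dlit, MF.eval, h]

theorem eval_lit_iff (v : State n) (b : Bool) (i : Fin n) :
    (lit b i).eval v ↔ v i = b := by
  cases b <;> simp [lit, MF.eval]

theorem not_eval_encS (s : State n) : ¬ (encS s).eval s := by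
  unfold encS
  induction List.finRange n with
  | nil => simp [MF.eval]
  | cons i l ih => simpa [MF.eval, not_eval_dlit] using ih

theorem not_eval_testN (s : State n) : ¬ (testN s).eval s := by
  unfold testN
  induction List.finRange n with
  | nil => simp [MF.eval]
  | cons i l ih => simpa [MF.eval, not_eval_dlit] using ih

theorem eval_testP_iff (v s : State n) : (testP s).eval v ↔ v = s := by
  have key (l : List (Fin n)) :
      (l.foldr (fun i G => MF.tens (lit (s i) i) G) .one).eval v ↔ ∀ i ∈ l, v i = s i := by
    induction l with
    | nil => simp [MF.eval]
    | cons i l ih => simp [MF.eval, eval_lit_iff, ih]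
  simp [testP, key, funext_iff]

theorem mallSeq_lit_dlit (b : Bool) (i : Fin n) : MallSeq {lit b i, dlit b i} := by
  cases b
  · rw [Multiset.pair_comm]
    simpa [lit, dlit] using MallSeq.init i
  · simpa [lit, dlit] using MallSeq.init i

theorem mallSeq_encS_testP (s : State n) : MallSeq {encS s, testP s} := by
  unfold encS testP
  induction List.finRange n with
  | nil => exact .bot .one
  | cons i l ih =>
    refine .parr ?_
    have h := MallSeq.tens (mallSeq_lit_dlit (s i) i) (Multiset.pair_comm _ _ ▸ ih)
    convert h using 1
    simp only [List.foldr_cons, ← Multiset.singleton_add]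
    abel

/-- To prove a sequent containing `⟦s⟧` it suffices to use one of its literals,
provided the rest of the context can be absorbed. -/
theorem MallSeq.cons_encS {s : State n} (k : Fin n) {C : MF n}
    (h : ∀ Γ, MallSeq (C ::ₘ dlit (s k) k ::ₘ Γ)) (Γ : Multiset (MF n)) :
    MallSeq (encS s ::ₘ C ::ₘ Γ) := by
  have key (l : List (Fin n)) (hk : k ∈ l) : ∀ Γ, MallSeq
      (l.foldr (fun i G => MF.parr (dlit (s i) i) G) .bot ::ₘ C ::ₘ Γ) := by
    induction l with
    | nil => simp at hk
    | cons i l ih =>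
      intro Γ
      refine .parr ?_
      rcases List.mem_cons.1 hk with rfl | hk
      · rw [Multiset.cons_swap _ C, Multiset.cons_swap _ C]
        exact h _
      · rw [Multiset.cons_swap, Multiset.cons_swap (dlit _ _)]
        exact ih hk _
  exact key _ (List.mem_finRange k) Γ

theorem mallSeq_testN_cons {s : State n} (k : Fin n) {Γ : Multiset (MF n)}
    (h : MallSeq (.tens (dlit (s k) k) .top ::ₘ Γ)) : MallSeq (testN s ::ₘ Γ) := by
  have key (l : List (Fin n)) (hk : k ∈ l) : MallSeq
      (l.foldr (fun i G => MF.plus (.tens (dlit (s i) i) .top) G) .zero ::ₘ Γ) := by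
    induction l with
    | nil => simp at hk
    | cons i l ih =>
      rcases List.mem_cons.1 hk with rfl | hk
      · exact .plus1 h
      · exact .plus2 (ih hk)
  exact key _ (List.mem_finRange k)

theorem mallSeq_encS_testN {s s' : State n} (h : s ≠ s') :
    MallSeq {encS s, testN s'} := by
  obtain ⟨k, hk⟩ := Function.ne_iff.1 h
  refine MallSeq.cons_encS k (fun Γ => mallSeq_testN_cons k ?_) 0
  have hlit : dlit (s' k) k = lit (s k) k := by
    cases hs : s k <;> cases hs' : s' k <;> simp_all [lit, dlit]
  rw [hlit, ← Multiset.singleton_add (dlit _ _)]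
  exact .tens (mallSeq_lit_dlit (s k) k) (.top Γ)

end MuMALL

/-- **Firability tests in MALL.**  For distinct states `s`, `s'` on the
variables `a₁, …, aₙ`:
(i) the sequents `⊢ ⟦s⟧, test⁺(s)` and `⊢ ⟦s⟧, test⁻(s')` are both provable in
MALL; (ii) the sequents `⊢ ⟦s⟧, test⁻(s)` and `⊢ ⟦s⟧, test⁺(s')` are not. -/
theorem mall_firability_tests {n : ℕ} (s s' : MuMALL.State n) (hss : s ≠ s') :
    (MuMALL.MallSeq {MuMALL.encS s, MuMALL.testP s} ∧
      MuMALL.MallSeq {MuMALL.encS s, MuMALL.testN s'}) ∧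
    (¬ MuMALL.MallSeq {MuMALL.encS s, MuMALL.testN s} ∧
      ¬ MuMALL.MallSeq {MuMALL.encS s, MuMALL.testP s'}) := by
  refine ⟨⟨MuMALL.mallSeq_encS_testP s, MuMALL.mallSeq_encS_testN hss⟩, fun h => ?_, fun h => ?_⟩
  · simpa [MuMALL.not_eval_encS, MuMALL.not_eval_testN] using h.exists_eval s
  · simpa [MuMALL.not_eval_encS, MuMALL.eval_testP_iff, hss] using h.exists_eval s
end

section
/- (Invariant for the greatest fixed point encoding of AG) Let V = {a₁, …, aₙ} be a finite set of propositional variables, R a set of transition rules defining a serial transition system, F a CTL formula, and let S = {s₁, …, sₘ} be the set of states satisfying AG F (so every s ∈ S satisfies F and S is closed under all transitions of R). Assume that ⊢ ⟦s⟧, ⟦F⟧_R is provable in μMALL for every s ∈ S. Then, with invariant I := ⟦s₁⟧⊥ ⊕ … ⊕ ⟦sₘ⟧⊥, both premises of the ν rule for ⟦AG F⟧_R = νB (with B Y := ⟦F⟧_R & &_{s→s'∈R}(test⁻(s) ⊕ (test⁺(s) ⊗ (⟦s'⟧ ⅋ Y)))) are provable in μMALL for every s ∈ S, namely: (i) ⊢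 ⟦s⟧, I, and (ii) ⊢ B I, I⊥; consequently ⊢ ⟦s⟧, ⟦AG F⟧_R is provable in μMALL for every s ∈ S. -/
namespace MuMALL

/-- The body `B` of the greatest fixed point encoding of `AG F`:
`B Y = ⟦F⟧_R & &_{s→s'∈R}(test⁻(s) ⊕ (test⁺(s) ⊗ (⟦s'⟧ ⅋ Y)))`,
so that `⟦AG F⟧_R = ν B`. -/
def agBody (R : List (Rule n)) (φ : MF n) : MF n := .witha φ (encA R (.var 0))

end MuMALL

namespace MuMALL

variable {n : ℕ}

theorem dual_dlit (b : Bool) (i : Fin n) : (dlit b i).dual = lit b i := by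
  cases b <;> rfl

theorem dual_lit (b : Bool) (i : Fin n) : (lit b i).dual = dlit b i := by
  cases b <;> rfl

theorem dual_encS (s : State n) : (encS s).dual = testP s := by
  unfold encS testP
  induction List.finRange n with
  | nil => rfl
  | cons i l ih => simp [MF.dual, dual_dlit, ih]

theorem dual_testP (s : State n) : (testP s).dual = encS s := by
  unfold encS testP
  induction List.finRange n with
  | nil => rfl
  | cons i l ih => simp [MF.dual, dual_lit, ih]

theorem dual_bigPlus (l : List (MF n)) : (bigPlus l).dual = bigWith (l.map MF.dual) := by
  unfold bigPlus bigWith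
  induction l with
  | nil => rfl
  | cons B l ih => simp [MF.dual, ih]

theorem subst_lit (b : Bool) (i : Fin n) (C : MF n) (k : ℕ) : (lit b i).subst C k = lit b i := by
  cases b <;> rfl

theorem subst_dlit (b : Bool) (i : Fin n) (C : MF n) (k : ℕ) :
    (dlit b i).subst C k = dlit b i := by
  cases b <;> rfl

theorem subst_encS (s : State n) (C : MF n) (k : ℕ) : (encS s).subst C k = encS s := by
  unfold encS
  induction List.finRange n with
  | nil => rfl
  | cons i l ih => simp [MF.subst, subst_dlit, ih]

theorem subst_testP (s : State n) (C : MF n) (k : ℕ) : (testP s).subst C k = testP s := by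
  unfold testP
  induction List.finRange n with
  | nil => rfl
  | cons i l ih => simp [MF.subst, subst_lit, ih]

theorem subst_testN (s : State n) (C : MF n) (k : ℕ) : (testN s).subst C k = testN s := by
  unfold testN
  induction List.finRange n with
  | nil => rfl
  | cons i l ih => simp [MF.subst, subst_dlit, ih]

theorem subst_encA (R : List (Rule n)) (Y C : MF n) (k : ℕ) :
    (encA R Y).subst C k = encA R (Y.subst C k) := by
  unfold encA bigWith
  induction R with
  | nil => rfl
  | cons r R ih => simp [MF.subst, subst_testN, subst_testP, subst_encS, ih]

theorem subst_encE (R : List (Rule n)) (Y C : MF n) (k : ℕ) :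
    (encE R Y).subst C k = encE R (Y.subst C k) := by
  unfold encE bigPlus
  induction R with
  | nil => rfl
  | cons r R ih => simp [MF.subst, subst_testP, subst_encS, ih]

/-- The encoding of a CTL formula is closed. -/
theorem subst_encCTL (R : List (Rule n)) (F : CTL n) (C : MF n) (k : ℕ) :
    (encCTL R F).subst C k = encCTL R F := by
  induction F generalizing k <;>
    simp_all [encCTL, MF.subst, subst_encA, subst_encE, subst_testP]

theorem subst_agBody (R : List (Rule n)) (F : CTL n) (C : MF n) :
    (agBody R (encCTL R F)).subst C 0 = .witha (encCTL R F) (encA R C) := by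
  simp [agBody, MF.subst, subst_encA, subst_encCTL]

theorem MSeq.bigWith {l : List (MF n)} {Γ : Multiset (MF n)}
    (h : ∀ B ∈ l, MSeq (B ::ₘ Γ)) : MSeq (bigWith l ::ₘ Γ) := by
  induction l with
  | nil => exact .top Γ
  | cons B l ih =>
    exact .witha (h B (by simp)) (ih fun C hC => h C (by simp [hC]))

theorem MSeq.bigPlus {l : List (MF n)} {Γ : Multiset (MF n)} {B : MF n} (hB : B ∈ l)
    (h : MSeq (B ::ₘ Γ)) : MSeq (bigPlus l ::ₘ Γ) := by
  induction l with
  | nil => simp at hB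
  | cons C l ih =>
    rcases List.mem_cons.mp hB with rfl | hB
    · exact .plus1 h
    · exact .plus2 (ih hB)

theorem MSeq.lit_dlit (b : Bool) (i : Fin n) : MSeq {lit b i, dlit b i} := by
  cases b
  · rw [Multiset.pair_comm]
    exact .init i
  · exact .init i

theorem MSeq.dlit_dlit {b c : Bool} (h : b ≠ c) (i : Fin n) : MSeq {dlit b i, dlit c i} := by
  cases b <;> cases c <;> first | exact absurd rfl h | skip
  · exact .init i
  · rw [Multiset.pair_comm]
    exact .init i

theorem MSeq.testP_encS (s : State n) : MSeq {testP s, encS s} := by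
  unfold encS testP
  induction List.finRange n with
  | nil =>
    rw [Multiset.pair_comm]
    exact .bot .one
  | cons i l ih =>
    rw [Multiset.pair_comm]
    refine .parr ?_
    have h := MSeq.tens (MSeq.lit_dlit (s i) i) ih
    convert h using 1
    simp only [List.foldr_cons, ← Multiset.singleton_add]
    abel

theorem MSeq.encS_of_dlit {s : State n} {Γ : Multiset (MF n)}
    (h : MSeq (((List.finRange n : Multiset (Fin n)).map fun i => dlit (s i) i) + Γ)) :
    MSeq (encS s ::ₘ Γ) := by
  unfold encS
  revert h
  induction List.finRange n generalizing Γ with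
  | nil =>
    intro h
    exact .bot (by simpa using h)
  | cons i l ih =>
    intro h
    refine .parr ?_
    rw [Multiset.cons_swap]
    refine ih ?_
    convert h using 1
    rw [← Multiset.cons_coe, Multiset.map_cons, Multiset.cons_add, Multiset.add_cons]

theorem MSeq.testN_of_dlit {s : State n} {Γ : Multiset (MF n)} (i : Fin n)
    (h : MSeq (.tens (dlit (s i) i) .top ::ₘ Γ)) : MSeq (testN s ::ₘ Γ) := by
  have key : testN s =
      MuMALL.bigPlus ((List.finRange n).map fun i => .tens (dlit (s i) i) .top) := by
    simp [testN, MuMALL.bigPlus, List.foldr_map]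
  rw [key]
  exact .bigPlus (List.mem_map.mpr ⟨i, List.mem_finRange i, rfl⟩) h

theorem MSeq.testN_encS {s t : State n} (h : s ≠ t) : MSeq {testN s, encS t} := by
  obtain ⟨i, hi⟩ := Function.ne_iff.mp h
  rw [Multiset.pair_comm]
  refine .encS_of_dlit ?_
  have hmem : dlit (t i) i ∈
      (List.finRange n : Multiset (Fin n)).map fun i => dlit (t i) i :=
    Multiset.mem_map.mpr ⟨i, Multiset.mem_coe.mpr (List.mem_finRange i), rfl⟩
  obtain ⟨Δ, hΔ⟩ := Multiset.exists_cons_of_mem hmem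
  rw [hΔ, add_comm, Multiset.singleton_add]
  refine .testN_of_dlit i ?_
  rw [← Multiset.singleton_add]
  exact .tens (.dlit_dlit hi i) (.top Δ)

theorem sat_AG_step {R : List (Rule n)} {F : CTL n} {s s' : State n}
    (h : sat R (.AG F) s) (hs : step R s s') : sat R (.AG F) s' := by
  intro π hπ h0 k
  refine h (fun j => Nat.casesOn j s π) (fun j => ?_) rfl (k + 1)
  cases j with
  | zero =>
    subst h0
    exact hs
  | succ j => exact hπ j

/-- The invariant `⟦s₁⟧⊥ ⊕ … ⊕ ⟦sₘ⟧⊥` associated with the states `s₁, …, sₘ`. -/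
abbrev invariant (S : List (State n)) : MF n := bigPlus (S.map fun t => (encS t).dual)

theorem MSeq.encS_invariant {S : List (State n)} {s : State n} (hs : s ∈ S) :
    MSeq {encS s, invariant S} := by
  rw [Multiset.pair_comm]
  refine .bigPlus (List.mem_map.mpr ⟨s, hs, rfl⟩) ?_
  rw [dual_encS]
  exact .testP_encS s

theorem MSeq.encA_invariant {R : List (Rule n)} {S : List (State n)}
    (hS : ∀ s ∈ S, ∀ s', step R s s' → s' ∈ S) {s : State n} (hs : s ∈ S) :
    MSeq {encA R (invariant S), encS s} := by
  refine .bigWith fun B hB => ?_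
  obtain ⟨r, hr, rfl⟩ := List.mem_map.mp hB
  by_cases h : r.1 = s
  · subst h
    refine .plus2 ?_
    rw [← add_zero {encS r.1}]
    exact .tens (.testP_encS r.1) (.parr (.encS_invariant (hS r.1 hs r.2 hr)))
  · exact .plus1 (.testN_encS h)

theorem MSeq.agBody_invariant {R : List (Rule n)} {F : CTL n} {S : List (State n)}
    (hS : ∀ s ∈ S, ∀ s', step R s s' → s' ∈ S)
    (hF : ∀ s ∈ S, MSeq {encS s, encCTL R F}) :
    MSeq {(agBody R (encCTL R F)).subst (invariant S) 0, (invariant S).dual} := by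
  rw [subst_agBody, dual_bigPlus, Multiset.pair_comm]
  refine .bigWith fun B hB => ?_
  simp only [List.map_map, List.mem_map, Function.comp_apply] at hB
  obtain ⟨s, hs, rfl⟩ := hB
  rw [dual_encS, dual_testP, ← Multiset.insert_eq_cons, Multiset.pair_comm]
  refine .witha ?_ (.encA_invariant hS hs)
  rw [← Multiset.insert_eq_cons, Multiset.pair_comm]
  exact hF s hs

end MuMALL

/-- **Invariant for the greatest fixed point encoding of `AG`** (part of the
proof of Theorem 7).  Let `R` define a serial transition system, `F` a CTL
formula, and `S = {s₁, …, sₘ}` the set of states satisfying `AG F` (so every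
`s ∈ S` satisfies `F` and `S` is closed under all transitions of `R`).  Assume
`⊢ ⟦s⟧, ⟦F⟧_R` is provable in μMALL for every `s ∈ S`.  Then, with the
invariant `I := ⟦s₁⟧⊥ ⊕ … ⊕ ⟦sₘ⟧⊥`, both premises of the `ν` rule for
`⟦AG F⟧_R = νB` are provable in μMALL for every `s ∈ S`, namely
(i) `⊢ ⟦s⟧, I` and (ii) `⊢ B I, I⊥`; consequently `⊢ ⟦s⟧, ⟦AG F⟧_R` is provable
in μMALL for every `s ∈ S`. -/
theorem mumall_AG_invariant {n : ℕ} (R : List (MuMALL.Rule n))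
    (hser : ∀ s : MuMALL.State n, ∃ s', MuMALL.step R s s')
    (F : MuMALL.CTL n) (S : List (MuMALL.State n))
    (hS : ∀ s, s ∈ S ↔ MuMALL.sat R (MuMALL.CTL.AG F) s)
    (hF : ∀ s ∈ S, MuMALL.MSeq {MuMALL.encS s, MuMALL.encCTL R F}) :
    (∀ s ∈ S, MuMALL.MSeq
        {MuMALL.encS s, MuMALL.bigPlus (S.map fun t => (MuMALL.encS t).dual)}) ∧
    MuMALL.MSeq
      {(MuMALL.agBody R (MuMALL.encCTL R F)).subst
          (MuMALL.bigPlus (S.map fun t => (MuMALL.encS t).dual)) 0,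
        (MuMALL.bigPlus (S.map fun t => (MuMALL.encS t).dual)).dual} ∧
    (∀ s ∈ S, MuMALL.MSeq {MuMALL.encS s, MuMALL.encCTL R (MuMALL.CTL.AG F)}) := by
  have hcl : ∀ s ∈ S, ∀ s', MuMALL.step R s s' → s' ∈ S := fun s hs s' hst =>
    (hS s').mpr (MuMALL.sat_AG_step ((hS s).mp hs) hst)
  have hB := MuMALL.MSeq.agBody_invariant hcl hF
  refine ⟨fun s hs => .encS_invariant hs, hB, fun s hs => ?_⟩
  rw [Multiset.pair_comm]
  refine .nu (MuMALL.invariant S) ?_ hB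
  rw [← Multiset.insert_eq_cons, Multiset.pair_comm]
  exact .encS_invariant hs
end
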